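/- For every ε > 0 and every r ∈ ℕ there exists n = n(ε, r) ∈ ℕ with the following property: if m ≥ n and y = (1/m) Σ_{i=1}^m x_i, where (x_i)_{i=1}^m is a normalized block basis of (e_i) in the Schlumprecht space S that is (1 + ε/2)-equivalent to the unit vector basis of ℓ_1^m, then sup_{E_1 < E_2 < ⋯ < E_r} Σ_{i=1}^r ‖E_i y‖ ≤ ‖y‖ + ε, the supremum being over all finite sequences E_1 < ⋯ < E_r of finite subsets of ℕ. -/

import Mathlib

open Filter Topology

noncomputable section

/-- `f(t) = log₂(t+1)`. -/
def schF (t : ℝ) : ℝ := Real.logb 2 (t + 1)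

/-- For a finitely supported scalar sequence `a`, the vector `Σᵢ aᵢ eᵢ`. -/
def embed {S : Type*} [NormedAddCommGroup S] [NormedSpace ℝ S] (e : ℕ → S) (a : ℕ →₀ ℝ) : S :=
  a.sum fun i c => c • e i

/-- The restriction `Ex` of `x = Σ aᵢ eᵢ` to the coordinates in the finite set `E`. -/
def restr (a : ℕ →₀ ℝ) (E : Finset ℕ) : ℕ →₀ ℝ := a.filter (· ∈ E)

/-- `E₁ < E₂ < ⋯ < E_r` : a successive family of finite subsets of ℕ. -/
def Succ {r : ℕ} (E : Fin r → Finset ℕ) : Prop :=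
  ∀ i j : Fin r, i < j → ∀ m ∈ E i, ∀ n ∈ E j, m < n

/-- `S` is (a realization of) the Schlumprecht space with unit vector basis `e`:
a Banach space in which the span of `e` is dense and whose norm satisfies, on the
finitely supported vectors `Σ aᵢ eᵢ`, the implicit Schlumprecht equation. -/
structure IsSchlumprecht (S : Type*) [NormedAddCommGroup S] [NormedSpace ℝ S] (e : ℕ → S) :
    Prop where
  dense_span : Dense (Submodule.span ℝ (Set.range e) : Set S)
  norm_eq : ∀ a : ℕ →₀ ℝ,
    ‖embed e a‖ = max (⨆ i, |a i|)
      (sSup {c : ℝ | ∃ r : ℕ, 2 ≤ r ∧ ∃ E : Fin r → Finset ℕ, Succ E ∧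
        c = (schF r)⁻¹ * ∑ i, ‖embed e (restr a (E i))‖})

/-- `b` is a normalized block basis of the unit vector basis `e`. -/
def IsNormalizedBlockBasis {S : Type*} [NormedAddCommGroup S] [NormedSpace ℝ S] (e : ℕ → S)
    (b : ℕ → ℕ →₀ ℝ) : Prop :=
  (∀ k, b k ≠ 0) ∧ (∀ k, ∀ m ∈ (b k).support, ∀ n ∈ (b (k + 1)).support, m < n) ∧
  (∀ k, ‖embed e (b k)‖ = 1)

/-- The series `Σ g k` converges to `s` (convergence of partial sums). -/
def SeriesSum {S : Type*} [AddCommMonoid S] [TopologicalSpace S] (g : ℕ → S) (s : S) : Prop :=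
  Tendsto (fun m => ∑ k ∈ Finset.range m, g k) atTop (𝓝 s)

/-- `V` is isomorphic (linearly homeomorphic) to the S-sum `(Σₖ ⊕ X k)_S`,
where the S-sum consists of all `y : Π k, X k` such that `Σₖ ‖y k‖ e k` converges in `S`,
normed by `‖Σₖ ‖y k‖ e k‖`. -/
def IsoToSSum {S : Type*} [NormedAddCommGroup S] [NormedSpace ℝ S] (e : ℕ → S)
    (V : Type*) [NormedAddCommGroup V] [Module ℝ V]
    (X : ℕ → Type*) [∀ k, NormedAddCommGroup (X k)] [∀ k, Module ℝ (X k)] : Prop :=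
  ∃ (T : V →ₗ[ℝ] Π k, X k) (A B : ℝ), 0 < A ∧ 0 < B ∧
    (Set.range T = {y | ∃ s : S, SeriesSum (fun k => ‖y k‖ • e k) s}) ∧
    ∀ v : V, ∃ s : S, SeriesSum (fun k => ‖T v k‖ • e k) s ∧
      A * ‖v‖ ≤ ‖s‖ ∧ ‖s‖ ≤ B * ‖v‖

section

variable {S : Type*} [NormedAddCommGroup S] [NormedSpace ℝ S] {e : ℕ → S}

lemma embed_eq_linearCombination (a : ℕ →₀ ℝ) : embed e a = Finsupp.linearCombination ℝ e a :=
  rfl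

lemma embed_restr_smul_sum {ι : Type*} [Fintype ι] (c : ℝ) (b : ι → ℕ →₀ ℝ) (E : Finset ℕ) :
    embed e (restr (c • ∑ i, b i) E) = c • ∑ i, embed e (restr (b i) E) := by
  simp only [embed_eq_linearCombination, restr, Finsupp.filter_smul, map_smul]
  rw [Finsupp.filter_sum, map_sum]

lemma restr_restr (a : ℕ →₀ ℝ) (E F : Finset ℕ) : restr (restr a E) F = restr a (F ∩ E) := by
  ext p
  by_cases hF : p ∈ F <;> by_cases hE : p ∈ E <;> simp [restr, hE, hF]

lemma restr_eq_zero {a : ℕ →₀ ℝ} {E : Finset ℕ} (h : ¬ ∃ p ∈ E, p ∈ a.support) :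
    restr a E = 0 := by
  ext p
  by_cases hp : p ∈ E
  · have : a p = 0 := by_contra fun hne => h ⟨p, hp, Finsupp.mem_support_iff.2 hne⟩
    simp [restr, hp, this]
  · simp [restr, hp]

lemma Succ.eq_of_mem {r : ℕ} {E : Fin r → Finset ℕ} (hE : Succ E) {i j : Fin r} {p : ℕ}
    (hi : p ∈ E i) (hj : p ∈ E j) : i = j := by
  rcases lt_trichotomy i j with h | h | h
  · exact absurd (hE i j h p hi p hj) (lt_irrefl p)
  · exact h
  · exact absurd (hE j i h p hj p hi) (lt_irrefl p)

lemma norm_embed_restr_le_sum (a : ℕ →₀ ℝ) (E : Finset ℕ) :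
    ‖embed e (restr a E)‖ ≤ ∑ p ∈ a.support, if p ∈ E then |a p| * ‖e p‖ else 0 := by
  rw [← Finset.sum_filter]
  refine (norm_sum_le _ _).trans_eq (Finset.sum_congr (Finsupp.support_filter _ _) ?_)
  intro p hp
  simp [restr, (Finset.mem_filter.1 hp).2, norm_smul]

lemma Succ.sum_norm_embed_restr_le {r : ℕ} {E : Fin r → Finset ℕ} (hE : Succ E)
    (a : ℕ →₀ ℝ) :
    ∑ i, ‖embed e (restr a (E i))‖ ≤ ∑ p ∈ a.support, |a p| * ‖e p‖ := by
  refine (Finset.sum_le_sum fun i _ => norm_embed_restr_le_sum a (E i)).trans ?_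
  rw [Finset.sum_comm]
  refine Finset.sum_le_sum fun p _ => ?_
  by_cases h : ∃ i, p ∈ E i
  · obtain ⟨i, hi⟩ := h
    rw [Finset.sum_eq_single i (fun j _ hj => if_neg fun hp => hj (hE.eq_of_mem hp hi))
      (by simp), if_pos hi]
  · push Not at h
    rw [Finset.sum_eq_zero fun i _ => if_neg (h i)]
    positivity

lemma one_le_schF {t : ℝ} (ht : 1 ≤ t) : 1 ≤ schF t := by
  rw [schF, Real.le_logb_iff_rpow_le one_lt_two (by linarith)]
  norm_num
  linarith

/-- The set whose supremum enters the Schlumprecht equation is bounded. -/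
lemma bddAbove_schlumprecht (a : ℕ →₀ ℝ) :
    BddAbove {c : ℝ | ∃ r : ℕ, 2 ≤ r ∧ ∃ E : Fin r → Finset ℕ, Succ E ∧
        c = (schF r)⁻¹ * ∑ i, ‖embed e (restr a (E i))‖} := by
  refine ⟨∑ p ∈ a.support, |a p| * ‖e p‖, ?_⟩
  rintro c ⟨r, hr, E, hE, rfl⟩
  have h1 : (1 : ℝ) ≤ r := by exact_mod_cast (by omega : 1 ≤ r)
  refine (mul_le_of_le_one_left (Finset.sum_nonneg fun i _ => norm_nonneg _)
    (inv_le_one_of_one_le₀ (one_le_schF h1))).trans (hE.sum_norm_embed_restr_le a)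

lemma bddAbove_range_abs (a : ℕ →₀ ℝ) : BddAbove (Set.range fun i => |a i|) := by
  refine ⟨∑ p ∈ a.support, |a p|, ?_⟩
  rintro _ ⟨i, rfl⟩
  by_cases hi : i ∈ a.support
  · exact Finset.single_le_sum (f := fun p => |a p|) (fun p _ => abs_nonneg _) hi
  · simp only [Finsupp.notMem_support_iff.1 hi, abs_zero]
    exact Finset.sum_nonneg fun p _ => abs_nonneg _

/-- Coordinate restrictions are contractions in the Schlumprecht space. -/
lemma IsSchlumprecht.norm_embed_restr_le (hS : IsSchlumprecht S e) (a : ℕ →₀ ℝ)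
    (E : Finset ℕ) : ‖embed e (restr a E)‖ ≤ ‖embed e a‖ := by
  rw [hS.norm_eq (restr a E), hS.norm_eq a]
  refine max_le_max (ciSup_mono (bddAbove_range_abs a) fun i => ?_)
    (csSup_le_csSup (bddAbove_schlumprecht a) ?_ ?_)
  · by_cases hi : i ∈ E <;> simp [restr, hi]
  · exact ⟨_, 2, le_rfl, fun _ => ∅, fun i j _ m hm => by simp at hm, rfl⟩
  · rintro c ⟨r, hr, F, hF, rfl⟩
    refine ⟨r, hr, fun i => F i ∩ E, fun i j hij m hm n hn => hF i j hij m
      (Finset.mem_inter.1 hm).1 n (Finset.mem_inter.1 hn).1, ?_⟩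
    simp only [restr_restr]

end

/-- Two successive families of lengths `r` and `m` have at most `r + m` intersecting pairs. -/
lemma Succ.card_intersecting_le {r m : ℕ} {E : Fin r → Finset ℕ} {F : Fin m → Finset ℕ}
    (hE : Succ E) (hF : Succ F) :
    (Finset.univ.filter fun q : Fin r × Fin m => ∃ p ∈ E q.1, p ∈ F q.2).card ≤ r + m := by
  have hcard := Finset.card_le_card_of_injOn
    (s := Finset.univ.filter fun q : Fin r × Fin m => ∃ p ∈ E q.1, p ∈ F q.2)
    (t := Finset.range (r + m)) (fun q => (q.1 : ℕ) + q.2)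
    (fun q _ => by
      have := q.1.isLt
      have := q.2.isLt
      simp only [Finset.coe_range, Set.mem_Iio]
      omega) ?_
  · simpa using hcard
  · rintro ⟨i, j⟩ h ⟨i', j'⟩ h' heq
    simp only [Finset.coe_filter, Finset.mem_univ, true_and, Set.mem_ofPred_eq] at h h' heq
    obtain ⟨p, hpE, hpF⟩ := h
    obtain ⟨q, hqE, hqF⟩ := h'
    rcases lt_trichotomy i i' with hi | hi | hi
    · have hj : j' < j := by
        rw [Fin.lt_def] at hi ⊢
        omega
      exact absurd (hE i i' hi p hpE q hqE) (hF j' j hj q hqF p hpF).asymm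
    · subst hi
      have hj : j = j' := Fin.ext (by omega)
      rw [hj]
    · have hj : j < j' := by
        rw [Fin.lt_def] at hi ⊢
        omega
      exact absurd (hE i' i hi q hqE p hpE) (hF j j' hj p hpF q hqF).asymm

/-- Lemma 2 of Schlumprecht: for every `ε > 0` and `r ∈ ℕ` there is `n` such
that for every `m ≥ n` and every normalized block basis `(x i)_{i<m}` of `(e i)` which is
`(1 + ε/2)`-equivalent to the unit basis of `ℓ₁^m`, the vector `y = (1/m) Σᵢ xᵢ` satisfies
`Σᵢ ‖Eᵢ y‖ ≤ ‖y‖ + ε` for every chain `E₁ < ⋯ < E_r` of finite subsets of ℕ. -/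
theorem mean_of_l1_blocks_almost_indecomposable {S : Type*} [NormedAddCommGroup S]
    [NormedSpace ℝ S] [CompleteSpace S] (e : ℕ → S) (hS : IsSchlumprecht S e)
    (ε : ℝ) (hε : 0 < ε) (r : ℕ) :
    ∃ n : ℕ, ∀ m : ℕ, n ≤ m → ∀ b : Fin m → (ℕ →₀ ℝ),
      (∀ i, b i ≠ 0) →
      (∀ i j : Fin m, i < j → ∀ p ∈ (b i).support, ∀ q ∈ (b j).support, p < q) →
      (∀ i, ‖embed e (b i)‖ = 1) →
      (∃ A B : ℝ, 0 < A ∧ 0 < B ∧ A * B ≤ 1 + ε / 2 ∧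
        ∀ a : Fin m → ℝ,
          A⁻¹ * ∑ i, |a i| ≤ ‖embed e (∑ i, a i • b i)‖ ∧
          ‖embed e (∑ i, a i • b i)‖ ≤ B * ∑ i, |a i|) →
      ∀ E : Fin r → Finset ℕ, Succ E →
        ∑ i, ‖embed e (restr ((m : ℝ)⁻¹ • ∑ i, b i) (E i))‖ ≤
          ‖embed e ((m : ℝ)⁻¹ • ∑ i, b i)‖ + ε := by
  obtain ⟨n, hn⟩ := exists_nat_gt (2 * r / ε)
  refine ⟨n + 1, fun m hm b _ hb hnorm hl1 E hE => ?_⟩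
  obtain ⟨A, B, hA, hB, hAB, hequiv⟩ := hl1
  have hm0 : (0 : ℝ) < m := by exact_mod_cast (by omega : 0 < m)
  have hnm : (n : ℝ) ≤ m := by exact_mod_cast (by omega : n ≤ m)
  have hB1 : 1 ≤ B := by
    have h := (hequiv (Pi.single ⟨0, by omega⟩ 1)).2
    simpa [Pi.single_apply, ite_smul, apply_ite abs, hnorm] using h
  have hA1 : A ≤ 1 + ε / 2 := by nlinarith
  have hlower : 1 - ε / 2 ≤ ‖embed e ((m : ℝ)⁻¹ • ∑ i, b i)‖ := by
    have h := (hequiv fun _ => (m : ℝ)⁻¹).1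
    rw [← Finset.smul_sum] at h
    have hsum : ∑ _i : Fin m, |(m : ℝ)⁻¹| = 1 := by
      simp [hm0.ne']
    rw [hsum, mul_one] at h
    refine le_trans ?_ h
    rw [← one_div, le_div_iff₀ hA]
    by_cases hε2 : ε ≤ 2 <;> nlinarith
  have hpair : ∀ i j, ‖embed e (restr (b j) (E i))‖ ≤
      if ∃ p ∈ E i, p ∈ (b j).support then (1 : ℝ) else 0 := by
    intro i j
    split_ifs with h
    · exact (hS.norm_embed_restr_le (b j) (E i)).trans_eq (hnorm j)
    · simp [restr_eq_zero h, embed]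
  have hcard := hE.card_intersecting_le (F := fun j => (b j).support) hb
  have hupper : ∑ i, ‖embed e (restr ((m : ℝ)⁻¹ • ∑ i, b i) (E i))‖ ≤
      (m : ℝ)⁻¹ * (r + m) := by
    calc ∑ i, ‖embed e (restr ((m : ℝ)⁻¹ • ∑ i, b i) (E i))‖
        ≤ ∑ i, (m : ℝ)⁻¹ * ∑ j, if ∃ p ∈ E i, p ∈ (b j).support then (1 : ℝ) else 0 := by
          refine Finset.sum_le_sum fun i _ => ?_
          rw [embed_restr_smul_sum, norm_smul, Real.norm_of_nonneg (inv_nonneg.2 hm0.le)]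
          gcongr
          exact (norm_sum_le _ _).trans (Finset.sum_le_sum fun j _ => hpair i j)
      _ = (m : ℝ)⁻¹ * ((Finset.univ.filter fun q : Fin r × Fin m =>
            ∃ p ∈ E q.1, p ∈ (b q.2).support).card : ℝ) := by
          rw [← Finset.mul_sum, ← Fintype.sum_prod_type', Finset.sum_boole]
      _ ≤ (m : ℝ)⁻¹ * (r + m) := by
          gcongr
          exact_mod_cast hcard
  have hr : (m : ℝ)⁻¹ * (r + m) ≤ 1 + ε / 2 := by
    rw [inv_mul_le_iff₀ hm0]
    have := (div_lt_iff₀ hε).1 (hn.trans_le hnm)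
    linarith
  linarith
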